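/- For every real α with 0 < α < 2 and every real β, there exists a constant C = C(α,β) > 0 such that |E_{α,β}(-η)| ≤ C/(1+η) for all real η ≥ 0. -/

import Mathlib

/-- The Mittag-Leffler function `E_{α,β}(x) = ∑_{k=0}^∞ x^k / Γ(αk + β)` for real `x`,
where `1/Γ` is interpreted as its entire extension (Mathlib's `Real.Gamma` vanishes at the
poles, so division yields `0` there). The series converges absolutely for every `x`. -/
noncomputable def mittagLeffler (α β x : ℝ) : ℝ :=
  ∑' k : ℕ, x ^ k / Real.Gamma (α * k + β)

open Complex in
theorem norm_Gamma_half_add_mul_I_sq (y : ℝ) :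
    ‖Gamma (1 / 2 + y * I)‖ ^ 2 = Real.pi / Real.cosh (Real.pi * y) := by
  have h := Gamma_mul_Gamma_one_sub (1 / 2 + y * I)
  have hconj : (1 : ℂ) - (1 / 2 + y * I) = (starRingEnd ℂ) (1 / 2 + y * I) := by
    apply Complex.ext <;> norm_num
  have hsin : sin (Real.pi * (1 / 2 + y * I)) = cosh (Real.pi * y) := by
    rw [show (Real.pi : ℂ) * (1 / 2 + y * I) = Real.pi * y * I + Real.pi / 2 by ring,
      sin_add_pi_div_two, cos_mul_I]
  rw [hconj, Gamma_conj, mul_conj, hsin, normSq_eq_norm_sq] at h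
  exact_mod_cast h

open Filter Topology in
/-- The ratio `‖Γ(x + iy)‖ / Γ(x)` is at least its value at `x = 1/2`. -/
theorem norm_Gamma_half_mul_Gamma_le {x : ℝ} (hx : 1 / 2 ≤ x) (y : ℝ) :
    ‖Complex.Gamma (1 / 2 + y * Complex.I)‖ * Real.Gamma x ≤
      ‖Complex.Gamma (x + y * Complex.I)‖ * Real.Gamma (1 / 2) := by
  have h1 := ((Complex.GammaSeq_tendsto_Gamma (1 / 2 + y * Complex.I)).norm.mul
    (Real.GammaSeq_tendsto_Gamma x))
  have h2 := ((Complex.GammaSeq_tendsto_Gamma (x + y * Complex.I)).norm.mul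
    (Real.GammaSeq_tendsto_Gamma (1 / 2)))
  refine le_of_tendsto_of_tendsto h1 h2 ?_
  filter_upwards [eventually_gt_atTop 0] with n hn
  have hn' : (0 : ℝ) < n := by exact_mod_cast hn
  have hnorm : ∀ a : ℝ, ‖Complex.GammaSeq (a + y * Complex.I) n‖ =
      (n : ℝ) ^ a * n.factorial / ∏ j ∈ Finset.range (n + 1), ‖(a + y * Complex.I + j : ℂ)‖ := by
    intro a
    rw [Complex.GammaSeq, norm_div, norm_mul, norm_prod, ← Complex.ofReal_natCast,
      Complex.norm_cpow_eq_rpow_re_of_pos hn']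
    simp
  have hpos : ∀ a : ℝ, 0 < a → ∀ j : ℕ, 0 < ‖(a + y * Complex.I + j : ℂ)‖ := by
    intro a ha j
    rw [norm_pos_iff]
    intro h
    have := congrArg Complex.re h
    simp only [Complex.add_re, Complex.ofReal_re, Complex.mul_re, Complex.I_re, mul_zero,
      Complex.ofReal_im, zero_mul, sub_zero, Complex.natCast_re, Complex.zero_re, add_zero] at this
    have hj : (0 : ℝ) ≤ j := j.cast_nonneg
    linarith
  have hhalf := hnorm (1 / 2)
  have hhalf' := hpos (1 / 2) (by norm_num)
  push_cast at hhalf hhalf'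
  have hx0 : 0 < x := by linarith
  rw [hhalf, hnorm, Real.GammaSeq, Real.GammaSeq, div_mul_div_comm, div_mul_div_comm,
    ← Finset.prod_mul_distrib, ← Finset.prod_mul_distrib]
  have hprod : ∏ j ∈ Finset.range (n + 1), ‖(x + y * Complex.I + j : ℂ)‖ * (1 / 2 + (j : ℝ)) ≤
      ∏ j ∈ Finset.range (n + 1), ‖(1 / 2 + y * Complex.I + j : ℂ)‖ * (x + (j : ℝ)) := by
    refine Finset.prod_le_prod (fun j _ => by positivity) fun j _ => ?_
    have hj : (0 : ℝ) ≤ j := j.cast_nonneg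
    refine le_of_sq_le_sq ?_ (by positivity)
    rw [mul_pow, mul_pow, ← Complex.normSq_eq_norm_sq, ← Complex.normSq_eq_norm_sq,
      Complex.normSq_apply, Complex.normSq_apply]
    simp
    have hle : (2⁻¹ + (j : ℝ)) ^ 2 ≤ (x + j) ^ 2 := by gcongr; linarith
    nlinarith [mul_le_mul_of_nonneg_left hle (sq_nonneg y)]
  have hprod_pos : 0 < ∏ j ∈ Finset.range (n + 1),
      ‖(x + y * Complex.I + j : ℂ)‖ * (1 / 2 + (j : ℝ)) :=
    Finset.prod_pos fun j _ => mul_pos (hpos x hx0 j) (by positivity)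
  rw [mul_mul_mul_comm, mul_comm ((n : ℝ) ^ (1 / 2 : ℝ)), mul_mul_mul_comm ((n : ℝ) ^ x)]
  gcongr

open Real MeasureTheory Set in
theorem rpow_mul_exp_neg_le_Gamma {x R : ℝ} (hx : 1 ≤ x) (hR : 0 < R) :
    R ^ (x - 1) * exp (-R) ≤ Gamma x := by
  have hx0 : 0 < x := by linarith
  rw [Gamma_eq_integral hx0, ← integral_exp_neg_Ioi, ← integral_const_mul]
  have hint := GammaIntegral_convergent hx0
  calc ∫ t in Ioi R, R ^ (x - 1) * exp (-t)
      ≤ ∫ t in Ioi R, exp (-t) * t ^ (x - 1) := by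
        refine setIntegral_mono_on ?_ (hint.mono_set (Ioi_subset_Ioi hR.le)) measurableSet_Ioi ?_
        · exact (integrableOn_exp_neg_Ioi R).const_mul _
        · intro t ht
          rw [mul_comm]
          gcongr
          exact le_of_lt ht
    _ ≤ _ := by
        refine setIntegral_mono_set hint ?_ (Ioi_subset_Ioi hR.le).eventuallyLE
        filter_upwards [ae_restrict_mem measurableSet_Ioi] with t ht
        have : 0 < t := ht
        simp only [Pi.zero_apply]
        positivity

theorem norm_Gamma_inv_le_of_one_le_re {R : ℝ} (hR : 0 < R) {x : ℝ} (hx : 1 ≤ x) (y : ℝ) :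
    ‖(Complex.Gamma (x + y * Complex.I))⁻¹‖ ≤
      Real.exp R * R * R ^ (-x) * Real.exp (Real.pi / 2 * |y|) := by
  have hx0 : 0 < x := by linarith
  have hcosh : Real.cosh (Real.pi * y) ≤ Real.exp (Real.pi / 2 * |y|) ^ 2 := by
    rw [← Real.cosh_abs, abs_mul, abs_of_pos Real.pi_pos, ← Real.exp_nat_mul, Real.cosh_eq]
    push_cast
    rw [show 2 * (Real.pi / 2 * |y|) = Real.pi * |y| by ring]
    have : Real.exp (-(Real.pi * |y|)) ≤ Real.exp (Real.pi * |y|) := by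
      gcongr
      have := mul_nonneg Real.pi_pos.le (abs_nonneg y)
      linarith
    linarith
  have hhalf : Real.sqrt Real.pi ≤
      ‖Complex.Gamma (1 / 2 + y * Complex.I)‖ * Real.exp (Real.pi / 2 * |y|) := by
    refine Real.sqrt_le_iff.mpr ⟨by positivity, ?_⟩
    rw [mul_pow, norm_Gamma_half_add_mul_I_sq, div_mul_eq_mul_div, le_div_iff₀ (Real.cosh_pos _)]
    gcongr
  have hcomp := norm_Gamma_half_mul_Gamma_le (by linarith : 1 / 2 ≤ x) y
  rw [Real.Gamma_one_half_eq] at hcomp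
  have hG := rpow_mul_exp_neg_le_Gamma hx hR
  have hGpos := Real.Gamma_pos_of_pos hx0
  have hle : Real.Gamma x ≤
      ‖Complex.Gamma (x + y * Complex.I)‖ * Real.exp (Real.pi / 2 * |y|) := by
    refine le_of_mul_le_mul_left ?_ (Real.sqrt_pos.mpr Real.pi_pos)
    calc √Real.pi * Real.Gamma x
        ≤ ‖Complex.Gamma (1 / 2 + y * Complex.I)‖ * Real.exp (Real.pi / 2 * |y|) *
          Real.Gamma x := by gcongr
      _ = (‖Complex.Gamma (1 / 2 + y * Complex.I)‖ * Real.Gamma x) *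
          Real.exp (Real.pi / 2 * |y|) := by ring
      _ ≤ (‖Complex.Gamma (x + y * Complex.I)‖ * √Real.pi) *
          Real.exp (Real.pi / 2 * |y|) := by gcongr
      _ = _ := by ring
  have hnpos : 0 < ‖Complex.Gamma (x + y * Complex.I)‖ :=
    pos_of_mul_pos_left (hGpos.trans_le hle) (Real.exp_pos _).le
  rw [norm_inv, inv_le_iff_one_le_mul₀ hnpos]
  calc (1 : ℝ) = Real.exp R * R * R ^ (-x) * (R ^ (x - 1) * Real.exp (-R)) := by
        rw [Real.rpow_neg hR.le, Real.rpow_sub_one hR.ne', Real.exp_neg]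
        have := (Real.rpow_pos_of_pos hR x).ne'
        field_simp
    _ ≤ Real.exp R * R * R ^ (-x) *
        (‖Complex.Gamma (x + y * Complex.I)‖ * Real.exp (Real.pi / 2 * |y|)) := by
        exact mul_le_mul_of_nonneg_left (hG.trans hle) (by positivity)
    _ = _ := by ring

/-- On each right half-plane `1/Γ` decays faster than any exponential in the real direction and
grows at most like `exp (δ |Im z|)` in the imaginary direction, for every `δ > π/2`. -/
theorem exists_norm_Gamma_inv_le (m : ℕ) {δ : ℝ} (hδ : Real.pi / 2 < δ) {R : ℝ} (hR : 0 < R) :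
    ∃ C > 0, ∀ x y : ℝ, 1 - m ≤ x →
      ‖(Complex.Gamma (x + y * Complex.I))⁻¹‖ ≤ C * R ^ (-x) * Real.exp (δ * |y|) := by
  induction m generalizing δ R with
  | zero =>
    refine ⟨Real.exp R * R, by positivity, fun x y hx => ?_⟩
    refine (norm_Gamma_inv_le_of_one_le_re hR (by simpa using hx) y).trans ?_
    gcongr
  | succ m ih =>
    obtain ⟨ε, hε, hδε⟩ : ∃ ε > 0, Real.pi / 2 < δ - ε :=
      ⟨(δ - Real.pi / 2) / 2, by linarith, by linarith⟩
    obtain ⟨C, hC, h⟩ := ih hδε (mul_pos (Real.exp_pos 1) hR)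
    refine ⟨Real.exp (2 * m) * (1 + ε⁻¹) * C * R⁻¹, by positivity,
      fun x y hx => ?_⟩
    push_cast at hx
    have hx' := h (x + 1) y (by linarith)
    have hre : 1 + |x| ≤ Real.exp (2 * m) * Real.exp (x + 1) := by
      rw [← Real.exp_add]
      refine le_trans ?_ (Real.add_one_le_exp _)
      have hm : (0 : ℝ) ≤ m := m.cast_nonneg
      rcases abs_cases x with h | h <;> linarith
    have him : 1 + |y| ≤ (1 + ε⁻¹) * Real.exp (ε * |y|) := by
      have h1 := Real.add_one_le_exp (ε * |y|)
      have h2 : (1 : ℝ) ≤ Real.exp (ε * |y|) := Real.one_le_exp (by positivity)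
      have h3 : |y| ≤ ε⁻¹ * Real.exp (ε * |y|) := by
        rw [inv_mul_eq_div, le_div_iff₀ hε]
        linarith
      linarith
    have hnorm : ‖(x + y * Complex.I : ℂ)‖ ≤ (1 + |x|) * (1 + |y|) := by
      refine (norm_add_le _ _).trans ?_
      simp only [Complex.norm_real, norm_mul, Complex.norm_I, mul_one, Real.norm_eq_abs]
      nlinarith [mul_nonneg (abs_nonneg x) (abs_nonneg y)]
    rw [Complex.one_div_Gamma_eq_self_mul_one_div_Gamma_add_one, norm_mul]
    have harg : (x + y * Complex.I + 1 : ℂ) = ((x + 1 : ℝ) : ℂ) + y * Complex.I := by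
      push_cast; ring
    rw [harg]
    calc ‖(x + y * Complex.I : ℂ)‖ * ‖(Complex.Gamma (((x + 1 : ℝ) : ℂ) + y * Complex.I))⁻¹‖
        ≤ ((Real.exp (2 * m) * Real.exp (x + 1)) * ((1 + ε⁻¹) * Real.exp (ε * |y|))) *
          (C * (Real.exp 1 * R) ^ (-(x + 1)) * Real.exp ((δ - ε) * |y|)) := by
          gcongr
          exact hnorm.trans (by gcongr)
      _ = _ := by
          rw [show δ * |y| = ε * |y| + (δ - ε) * |y| by ring, Real.exp_add (ε * |y|),
            Real.mul_rpow (Real.exp_pos 1).le hR.le, Real.exp_one_rpow, Real.exp_neg, neg_add,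
            Real.rpow_add hR, Real.rpow_neg_one, Real.exp_add x 1]
          field_simp

theorem half_exp_abs_le_cosh (x : ℝ) : Real.exp |x| / 2 ≤ Real.cosh x := by
  rw [← Real.cosh_abs, Real.cosh_eq]
  have := Real.exp_pos (-|x|)
  linarith

theorem integrable_exp_mul_abs_div_cosh {μ : ℝ} (hμ : μ < Real.pi) :
    MeasureTheory.Integrable fun t : ℝ => Real.exp (μ * |t|) / Real.cosh (Real.pi * t) := by
  have hexp : MeasureTheory.Integrable fun t : ℝ => 2 * Real.exp (-(Real.pi - μ) * |t|) := by
    refine MeasureTheory.Integrable.const_mul ?_ 2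
    rw [← MeasureTheory.integrableOn_univ, ← Set.Iic_union_Ioi (a := (0 : ℝ))]
    refine MeasureTheory.IntegrableOn.union ?_ ?_
    · refine (integrableOn_exp_mul_Iic (sub_pos.mpr hμ) 0).congr_fun (fun t ht => ?_)
        measurableSet_Iic
      simp only [abs_of_nonpos (Set.mem_Iic.mp ht)]
      congr 1; ring
    · refine (integrableOn_exp_mul_Ioi (neg_lt_zero.mpr (sub_pos.mpr hμ)) 0).congr_fun
        (fun t ht => ?_) measurableSet_Ioi
      simp only [abs_of_pos (Set.mem_Ioi.mp ht)]
  refine hexp.mono' ?_ (Filter.Eventually.of_forall fun t => ?_)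
  · refine Continuous.aestronglyMeasurable ?_
    exact Continuous.div (by fun_prop) (Real.continuous_cosh.comp (by fun_prop))
      fun t => (Real.cosh_pos _).ne'
  · have hc := half_exp_abs_le_cosh (Real.pi * t)
    rw [abs_mul, abs_of_pos Real.pi_pos] at hc
    rw [Real.norm_of_nonneg (by have := Real.cosh_pos (Real.pi * t); positivity),
      div_le_iff₀ (Real.cosh_pos _)]
    calc Real.exp (μ * |t|) =
          2 * Real.exp (-(Real.pi - μ) * |t|) * (Real.exp (Real.pi * |t|) / 2) := by
          rw [mul_div_assoc', mul_assoc, ← Real.exp_add, mul_div_cancel_left₀ _ two_ne_zero]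
          congr 1; ring
      _ ≤ _ := by gcongr

open Filter Topology in
theorem integral_inv_cosh_pi_mul : ∫ t : ℝ, (Real.cosh (Real.pi * t))⁻¹ = 1 := by
  have hint : MeasureTheory.Integrable fun t : ℝ => (Real.cosh (Real.pi * t))⁻¹ := by
    simpa using integrable_exp_mul_abs_div_cosh Real.pi_pos
  have hderiv : ∀ t : ℝ, HasDerivAt (fun t => 2 / Real.pi * Real.arctan (Real.exp (Real.pi * t)))
      (Real.cosh (Real.pi * t))⁻¹ t := by
    intro t
    have h1 := ((((hasDerivAt_id t).const_mul Real.pi).exp).arctan).const_mul (2 / Real.pi)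
    convert! h1 using 1
    simp only [id, mul_one]
    rw [Real.cosh_eq, Real.exp_neg]
    have := Real.exp_pos (Real.pi * t)
    have := Real.pi_pos
    field_simp
    ring
  have hbot : Tendsto (fun t => 2 / Real.pi * Real.arctan (Real.exp (Real.pi * t))) atBot
      (𝓝 (2 / Real.pi * Real.arctan 0)) :=
    ((Real.continuous_arctan.tendsto 0).comp (Real.tendsto_exp_atBot.comp
      (tendsto_id.const_mul_atBot Real.pi_pos))).const_mul _
  have htop : Tendsto (fun t => 2 / Real.pi * Real.arctan (Real.exp (Real.pi * t))) atTop
      (𝓝 (2 / Real.pi * (Real.pi / 2))) :=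
    ((Real.tendsto_arctan_atTop.mono_right nhdsWithin_le_nhds).comp (Real.tendsto_exp_atTop.comp
      (tendsto_id.const_mul_atTop Real.pi_pos))).const_mul _
  rw [MeasureTheory.integral_of_hasDerivAt_of_tendsto hderiv hint hbot htop]
  have := Real.pi_pos
  simp

theorem Complex.half_exp_sub_half_le_norm_sin (z : ℂ) :
    Real.exp |z.im| / 2 - 1 / 2 ≤ ‖Complex.sin z‖ := by
  have h1 : ‖Complex.exp (-z * Complex.I)‖ = Real.exp z.im := by simp [Complex.norm_exp]
  have h2 : ‖Complex.exp (z * Complex.I)‖ = Real.exp (-z.im) := by simp [Complex.norm_exp]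
  have h3 : ‖Complex.sin z‖ =
      ‖Complex.exp (-z * Complex.I) - Complex.exp (z * Complex.I)‖ / 2 := by
    simp [Complex.sin]
  have h4 := abs_norm_sub_norm_le (Complex.exp (-z * Complex.I)) (Complex.exp (z * Complex.I))
  rw [h1, h2] at h4
  rw [h3]
  rcases abs_cases z.im with ⟨h, h'⟩ | ⟨h, h'⟩ <;> rw [h]
  · have : Real.exp (-z.im) ≤ 1 := Real.exp_le_one_iff.mpr (by linarith)
    have := (abs_le.mp h4).2
    linarith
  · have : Real.exp (z.im) ≤ 1 := Real.exp_le_one_iff.mpr (by linarith)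
    have := (abs_le.mp h4).1
    linarith

section strip

open Complex MeasureTheory Filter Topology

theorem integrable_div_cosh_of_norm_le {h : ℂ → ℂ} (hd : Differentiable ℂ h) {C μ : ℝ}
    (hμ : μ < Real.pi) (a : ℝ) (hb : ∀ y : ℝ, ‖h (a + y * I)‖ ≤ C * Real.exp (μ * |y|)) :
    Integrable fun t : ℝ => h (a + t * I) / (Real.cosh (Real.pi * t) : ℂ) := by
  refine ((integrable_exp_mul_abs_div_cosh hμ).const_mul C).mono' ?_
    (Eventually.of_forall fun t => ?_)
  · refine Continuous.aestronglyMeasurable ?_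
    refine Continuous.div (hd.continuous.comp (by fun_prop))
      (continuous_ofReal.comp (Real.continuous_cosh.comp (by fun_prop))) fun t => ?_
    exact_mod_cast (Real.cosh_pos _).ne'
  · rw [norm_div, norm_real, Real.norm_of_nonneg (Real.cosh_pos _).le, ← mul_div_assoc]
    have := Real.cosh_pos (Real.pi * t)
    gcongr
    exact hb t

theorem sin_pi_mul_half_add (t : ℝ) :
    sin (Real.pi * (((1 / 2 : ℝ) : ℂ) + t * I)) = (Real.cosh (Real.pi * t) : ℂ) := by
  push_cast
  rw [show (Real.pi : ℂ) * (1 / 2 + t * I) = Real.pi * t * I + Real.pi / 2 by ring,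
    sin_add_pi_div_two, cos_mul_I]

theorem sin_pi_mul_neg_half_add (t : ℝ) :
    sin (Real.pi * (((-1 / 2 : ℝ) : ℂ) + t * I)) = -(Real.cosh (Real.pi * t) : ℂ) := by
  push_cast
  rw [show (Real.pi : ℂ) * (-1 / 2 + t * I) = Real.pi * t * I - Real.pi / 2 by ring,
    sin_sub_pi_div_two, cos_mul_I]

/-- A function vanishing at `0` can be divided by `sin (π z)` holomorphically on the strip
`|Re z| ≤ 1/2`. -/
theorem exists_differentiableOn_div_sin {h : ℂ → ℂ} (hd : Differentiable ℂ h) (h0 : h 0 = 0) :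
    ∃ φ : ℂ → ℂ, DifferentiableOn ℂ φ {z | |z.re| ≤ 1 / 2} ∧
      ∀ z ≠ 0, φ z = h z / sin (Real.pi * z) := by
  have hs : Differentiable ℂ fun z : ℂ => sin (Real.pi * z) := by fun_prop
  have hdsl : ∀ {f : ℂ → ℂ}, Differentiable ℂ f → Differentiable ℂ (dslope f 0) := fun hf =>
    differentiableOn_univ.mp
      ((differentiableOn_dslope Filter.univ_mem).mpr hf.differentiableOn)
  refine ⟨fun z => dslope h 0 z / dslope (fun z : ℂ => sin (Real.pi * z)) 0 z,
    (hdsl hd).differentiableOn.div (hdsl hs).differentiableOn ?_, ?_⟩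
  · intro z hz
    rcases eq_or_ne z 0 with rfl | hne
    · have hder : HasDerivAt (fun z : ℂ => sin (Real.pi * z)) Real.pi 0 := by
        have := ((hasDerivAt_id (0 : ℂ)).const_mul (Real.pi : ℂ)).csin
        simpa using this
      rw [dslope_same, hder.deriv]
      exact_mod_cast Real.pi_ne_zero
    · rw [dslope_of_ne _ hne, slope_def_field]
      simp only [mul_zero, sin_zero, sub_zero]
      refine div_ne_zero ?_ hne
      intro hsin
      obtain ⟨k, hk⟩ := Complex.sin_eq_zero_iff.mp hsin
      have hpi : (Real.pi : ℂ) ≠ 0 := by exact_mod_cast Real.pi_ne_zero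
      have hzk : z = k := by
        rw [mul_comm] at hk
        exact mul_right_cancel₀ hpi hk
      have hlt : |(k : ℝ)| < 1 := by
        have : |z.re| ≤ 1 / 2 := hz
        rw [hzk] at this
        simp only [intCast_re] at this
        linarith
      have : k = 0 := by
        have : |k| < 1 := by exact_mod_cast hlt
        exact Int.abs_lt_one_iff.mp this
      exact hne (by simp [hzk, this])
  · intro z hz
    simp only [dslope_of_ne _ hz, slope_def_field, h0, mul_zero, sin_zero, sub_zero]
    field_simp

theorem integral_strip_eq_zero {h : ℂ → ℂ} (hd : Differentiable ℂ h) (h0 : h 0 = 0) {C μ : ℝ}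
    (hμ : μ < Real.pi)
    (hb : ∀ x y : ℝ, |x| ≤ 1 / 2 → ‖h (x + y * I)‖ ≤ C * Real.exp (μ * |y|)) :
    (∫ t : ℝ, h ((1 / 2 : ℝ) + t * I) / (Real.cosh (Real.pi * t) : ℂ)) +
      ∫ t : ℝ, h ((-1 / 2 : ℝ) + t * I) / (Real.cosh (Real.pi * t) : ℂ) = 0 := by
  obtain ⟨φ, hφd, hφ⟩ := exists_differentiableOn_div_sin hd h0
  have hpos : ∀ t : ℝ, φ ((1 / 2 : ℝ) + t * I) =
      h ((1 / 2 : ℝ) + t * I) / (Real.cosh (Real.pi * t) : ℂ) := by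
    intro t
    rw [hφ, sin_pi_mul_half_add]
    intro hz
    simpa using congrArg re hz
  have hneg : ∀ t : ℝ, φ ((-1 / 2 : ℝ) + t * I) =
      -(h ((-1 / 2 : ℝ) + t * I) / (Real.cosh (Real.pi * t) : ℂ)) := by
    intro t
    rw [hφ, sin_pi_mul_neg_half_add, div_neg]
    intro hz
    simpa using congrArg re hz
  have hhor : ∀ y : ℝ, y ≠ 0 → ‖∫ x : ℝ in (-1 / 2)..(1 / 2), φ (x + y * I)‖ ≤
      C * Real.exp (μ * |y|) / (Real.exp (Real.pi * |y|) / 2 - 1 / 2) := by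
    intro y hy
    have hlt : 1 < Real.exp (Real.pi * |y|) := by
      rw [Real.one_lt_exp_iff]
      have := Real.pi_pos
      have := abs_pos.mpr hy
      positivity
    have hle : ∀ x ∈ Set.uIoc (-1 / 2 : ℝ) (1 / 2), ‖φ (x + y * I)‖ ≤
        C * Real.exp (μ * |y|) / (Real.exp (Real.pi * |y|) / 2 - 1 / 2) := by
      intro x hx
      rw [Set.uIoc_of_le (by norm_num)] at hx
      have hx' : |x| ≤ 1 / 2 := abs_le.mpr ⟨by linarith [hx.1], hx.2⟩
      have hne : (x + y * I : ℂ) ≠ 0 := by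
        intro hz
        exact hy (by simpa using congrArg im hz)
      have hsin := half_exp_sub_half_le_norm_sin (Real.pi * (x + y * I))
      simp only [mul_im, ofReal_re, ofReal_im, zero_mul, add_zero, add_im, I_im, mul_one, I_re,
        mul_zero, zero_add, abs_mul, abs_of_pos Real.pi_pos] at hsin
      rw [hφ _ hne, norm_div]
      have hnum := hb x y hx'
      exact div_le_div₀ ((norm_nonneg _).trans hnum) hnum (by linarith) hsin
    have := intervalIntegral.norm_integral_le_of_norm_le_const hle
    norm_num at this ⊢
    exact this
  have hlim : Tendsto (fun T : ℝ =>
      C * Real.exp (μ * T) / (Real.exp (Real.pi * T) / 2 - 1 / 2)) atTop (𝓝 0) := by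
    have h1 : Tendsto (fun T : ℝ => Real.exp (-((Real.pi - μ) * T))) atTop (𝓝 0) :=
      Real.tendsto_exp_neg_atTop_nhds_zero.comp
        (tendsto_id.const_mul_atTop (sub_pos.mpr hμ))
    have h2 : Tendsto (fun T : ℝ => Real.exp (-(Real.pi * T))) atTop (𝓝 0) :=
      Real.tendsto_exp_neg_atTop_nhds_zero.comp (tendsto_id.const_mul_atTop Real.pi_pos)
    have h3 := (h1.const_mul C).div ((tendsto_const_nhds (x := (1 / 2 : ℝ))).sub
      (h2.const_mul (1 / 2))) (by norm_num)
    simp only [mul_zero, zero_div] at h3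
    refine h3.congr fun T => ?_
    simp only [Pi.div_apply]
    rw [← mul_div_mul_right (C * Real.exp (μ * T)) _ (Real.exp_ne_zero (-(Real.pi * T))),
      mul_assoc, ← Real.exp_add, sub_mul (Real.exp (Real.pi * T) / 2),
      div_mul_eq_mul_div (Real.exp (Real.pi * T)), ← Real.exp_add, add_neg_cancel, Real.exp_zero]
    congr 3; ring
  have hbot : Tendsto (fun T : ℝ => ∫ x : ℝ in (-1 / 2)..(1 / 2), φ (x + (-T : ℝ) * I)) atTop
      (𝓝 0) := by
    refine squeeze_zero_norm' ?_ hlim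
    filter_upwards [eventually_gt_atTop 0] with T hT
    simpa [abs_of_pos hT] using hhor (-T) (neg_ne_zero.mpr hT.ne')
  have htop : Tendsto (fun T : ℝ => ∫ x : ℝ in (-1 / 2)..(1 / 2), φ (x + T * I)) atTop
      (𝓝 0) := by
    refine squeeze_zero_norm' ?_ hlim
    filter_upwards [eventually_gt_atTop 0] with T hT
    simpa [abs_of_pos hT] using hhor T hT.ne'
  have hvpos := intervalIntegral_tendsto_integral
    (integrable_div_cosh_of_norm_le hd hμ (1 / 2) fun y => hb _ y (by norm_num [abs_le]))
    tendsto_neg_atTop_atBot tendsto_id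
  have hvneg := intervalIntegral_tendsto_integral
    (integrable_div_cosh_of_norm_le hd hμ (-1 / 2) fun y => hb _ y (by norm_num [abs_le]))
    tendsto_neg_atTop_atBot tendsto_id
  have hrect : ∀ T : ℝ, (∫ x : ℝ in (-1 / 2)..(1 / 2), φ (x + (-T : ℝ) * I)) -
      (∫ x : ℝ in (-1 / 2)..(1 / 2), φ (x + T * I)) +
      I * ((∫ t : ℝ in (-T)..T, h ((1 / 2 : ℝ) + t * I) / (Real.cosh (Real.pi * t) : ℂ)) +
        ∫ t : ℝ in (-T)..T, h ((-1 / 2 : ℝ) + t * I) / (Real.cosh (Real.pi * t) : ℂ)) = 0 := by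
    intro T
    have hsub : (Set.uIcc (-1 / 2) (1 / 2) ×ℂ Set.uIcc (-T) T) ⊆ {z : ℂ | |z.re| ≤ 1 / 2} := by
      intro z hz
      have hz' := hz.1
      simp only [Set.mem_preimage] at hz'
      rw [Set.uIcc_of_le (by norm_num)] at hz'
      exact abs_le.mpr ⟨by linarith [hz'.1], hz'.2⟩
    have := integral_boundary_rect_eq_zero_of_differentiableOn φ ⟨-1 / 2, -T⟩ ⟨1 / 2, T⟩
      (hφd.mono hsub)
    simp only [hpos, hneg, intervalIntegral.integral_neg, smul_eq_mul] at this
    rw [← this]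
    ring
  have hsum := (hbot.sub htop).add ((hvpos.add hvneg).const_mul I)
  have hzero := tendsto_nhds_unique (hsum.congr hrect) tendsto_const_nhds
  simpa using hzero

/-- The value of a holomorphic function at the centre of the strip `|Re z| ≤ 1/2` as a Poisson
integral over its boundary. -/
theorem integral_strip_eq_two_mul {h : ℂ → ℂ} (hd : Differentiable ℂ h) {C μ : ℝ}
    (hμ0 : 0 ≤ μ) (hμ : μ < Real.pi)
    (hb : ∀ x y : ℝ, |x| ≤ 1 / 2 → ‖h (x + y * I)‖ ≤ C * Real.exp (μ * |y|)) :
    (∫ t : ℝ, h ((1 / 2 : ℝ) + t * I) / (Real.cosh (Real.pi * t) : ℂ)) +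
      ∫ t : ℝ, h ((-1 / 2 : ℝ) + t * I) / (Real.cosh (Real.pi * t) : ℂ) = 2 * h 0 := by
  have hconst : ∀ y : ℝ, ‖h 0‖ ≤ ‖h 0‖ * Real.exp (μ * |y|) := fun y =>
    le_mul_of_one_le_right (norm_nonneg _) (Real.one_le_exp (by positivity))
  have hsub := integral_strip_eq_zero (h := fun z => h z - h 0) (hd.sub_const _) (sub_self _)
    (C := C + ‖h 0‖) hμ fun x y hx => by
      rw [add_mul]
      exact (norm_sub_le _ _).trans (add_le_add (hb x y hx) (hconst y))
  have hint : Integrable fun t : ℝ => h 0 / (Real.cosh (Real.pi * t) : ℂ) :=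
    integrable_div_cosh_of_norm_le (h := fun _ => h 0) (differentiable_const _) hμ 0 hconst
  have hval : ∫ t : ℝ, h 0 / (Real.cosh (Real.pi * t) : ℂ) = h 0 := by
    simp only [div_eq_mul_inv, ← ofReal_inv]
    rw [integral_const_mul, integral_complex_ofReal, integral_inv_cosh_pi_mul]
    simp
  simp only [sub_div] at hsub
  rw [integral_sub (integrable_div_cosh_of_norm_le hd hμ (1 / 2) fun y =>
      hb _ y (by norm_num [abs_le])) hint,
    integral_sub (integrable_div_cosh_of_norm_le hd hμ (-1 / 2) fun y =>
      hb _ y (by norm_num [abs_le])) hint, hval] at hsub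
  linear_combination hsub

theorem norm_integral_div_cosh_le {h : ℂ → ℂ} {C μ : ℝ} (hμ : μ < Real.pi) (a : ℝ)
    (hb : ∀ y : ℝ, ‖h (a + y * I)‖ ≤ C * Real.exp (μ * |y|)) :
    ‖∫ t : ℝ, h (a + t * I) / (Real.cosh (Real.pi * t) : ℂ)‖ ≤
      C * ∫ t : ℝ, Real.exp (μ * |t|) / Real.cosh (Real.pi * t) := by
  rw [← integral_const_mul]
  refine norm_integral_le_of_norm_le ((integrable_exp_mul_abs_div_cosh hμ).const_mul C)
    (Eventually.of_forall fun t => ?_)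
  rw [norm_div, norm_real, Real.norm_of_nonneg (Real.cosh_pos _).le, ← mul_div_assoc]
  have := Real.cosh_pos (Real.pi * t)
  gcongr
  exact hb t

/-- Alternating sums of a holomorphic function of exponential type less than `π`. -/
theorem tendsto_alternating_sum {g : ℂ → ℂ} (hd : Differentiable ℂ g) {C μ r : ℝ}
    (hμ0 : 0 ≤ μ) (hμ : μ < Real.pi) (hr0 : 0 < r) (hr1 : r < 1)
    (hb : ∀ x y : ℝ, -1 / 2 ≤ x → ‖g (x + y * I)‖ ≤ C * r ^ x * Real.exp (μ * |y|)) :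
    Tendsto (fun N : ℕ => ∑ k ∈ Finset.range N, (-1) ^ k * g k) atTop
      (𝓝 ((∫ t : ℝ, g ((-1 / 2 : ℝ) + t * I) / (Real.cosh (Real.pi * t) : ℂ)) / 2)) := by
  set J : ℕ → ℂ := fun n =>
    ∫ t : ℝ, g (((n - 1 / 2 : ℝ) : ℂ) + t * I) / (Real.cosh (Real.pi * t) : ℂ) with hJ
  have hC : 0 ≤ C := by simpa using (norm_nonneg _).trans (hb 0 0 (by norm_num))
  have hstep : ∀ n : ℕ, J (n + 1) + J n = 2 * g n := by
    intro n
    have := integral_strip_eq_two_mul (h := fun z => g (n + z))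
      (hd.comp (differentiable_id.const_add _)) (C := C * r ^ ((n : ℝ) - 1 / 2)) hμ0 hμ ?_
    · rw [add_zero] at this
      rw [← this]
      congr 1 <;> simp only [hJ] <;> congr 1 with t <;> congr 2 <;> push_cast <;> ring
    · intro x y hx
      have hx' := abs_le.mp hx
      have hn : (0 : ℝ) ≤ n := n.cast_nonneg
      have := hb (n + x) y (by linarith)
      push_cast at this
      rw [add_assoc] at this
      refine this.trans ?_
      have : r ^ (n + x) ≤ r ^ ((n : ℝ) - 1 / 2) :=
        Real.rpow_le_rpow_of_exponent_ge hr0 hr1.le (by linarith)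
      gcongr
  have hsum : ∀ N : ℕ, ∑ k ∈ Finset.range N, (-1) ^ k * g k = (J 0 - (-1) ^ N * J N) / 2 := by
    intro N
    induction N with
    | zero => simp
    | succ N ih =>
      rw [Finset.sum_range_succ, ih, pow_succ]
      linear_combination (-(-1) ^ N / 2) * hstep N
  have hJle : ∀ N : ℕ, ‖(-1) ^ N * J N‖ ≤ C * (r ^ N * r ^ (-1 / 2 : ℝ)) *
      ∫ t : ℝ, Real.exp (μ * |t|) / Real.cosh (Real.pi * t) := by
    intro N
    rw [norm_mul, norm_pow, norm_neg, norm_one, one_pow, one_mul]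
    refine norm_integral_div_cosh_le hμ _ fun y => ?_
    rw [show (N : ℝ) - 1 / 2 = N + -1 / 2 by ring]
    have hn : (0 : ℝ) ≤ N := N.cast_nonneg
    have := hb (N + -1 / 2) y (by linarith)
    rwa [Real.rpow_add hr0, Real.rpow_natCast] at this
  have hJlim : Tendsto (fun N : ℕ => (-1) ^ N * J N) atTop (𝓝 0) := by
    refine squeeze_zero_norm hJle ?_
    have := (((tendsto_pow_atTop_nhds_zero_of_lt_one hr0.le hr1).mul_const
      (r ^ (-1 / 2 : ℝ))).const_mul C).mul_const
      (∫ t : ℝ, Real.exp (μ * |t|) / Real.cosh (Real.pi * t))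
    simpa using this
  have hJ0 : J 0 = ∫ t : ℝ, g ((-1 / 2 : ℝ) + t * I) / (Real.cosh (Real.pi * t) : ℂ) := by
    simp only [hJ]
    norm_num
  rw [← hJ0]
  have := ((tendsto_const_nhds (x := J 0)).sub hJlim).div_const 2
  rw [sub_zero] at this
  exact this.congr fun N => (hsum N).symm

end strip

theorem exists_norm_Gamma_inv_linear_le {α : ℝ} (hα : 0 < α) (β : ℝ) {δ : ℝ}
    (hδ : Real.pi / 2 < δ) {b : ℝ} (hb : 0 < b) :
    ∃ C > 0, ∀ x y : ℝ, -1 / 2 ≤ x →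
      ‖(Complex.Gamma (α * (x + y * Complex.I) + β))⁻¹‖ ≤
        C * b ^ (-x) * Real.exp (α * δ * |y|) := by
  obtain ⟨C, hC, h⟩ := exists_norm_Gamma_inv_le ⌈1 - β + α / 2⌉₊ hδ
    (Real.rpow_pos_of_pos hb α⁻¹)
  refine ⟨C * (b ^ α⁻¹) ^ (-β), by positivity, fun x y hx => ?_⟩
  have hm := Nat.le_ceil (1 - β + α / 2)
  have := h (α * x + β) (α * y) (by nlinarith)
  rw [abs_mul, abs_of_pos hα, neg_add, Real.rpow_add (by positivity), ← Real.rpow_mul hb.le,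
    show α⁻¹ * -(α * x) = -x by field_simp] at this
  convert! this using 1
  · push_cast
    congr 3
    ring
  · rw [show α * δ * |y| = δ * (α * |y|) by ring]
    ring

theorem summable_mittagLeffler {α : ℝ} (hα : 0 < α) (β x : ℝ) :
    Summable fun k : ℕ => x ^ k / Real.Gamma (α * k + β) := by
  have hb : 0 < 2 * (|x| + 1) := by positivity
  obtain ⟨C, hC, h⟩ := exists_norm_Gamma_inv_linear_le hα β
    (lt_add_one (Real.pi / 2)) hb
  refine Summable.of_norm_bounded (summable_geometric_two.mul_left C) fun k => ?_
  have hk : (0 : ℝ) ≤ k := k.cast_nonneg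
  have hG := h k 0 (by linarith)
  have hcast : (Complex.Gamma (α * ((k : ℝ) + (0 : ℝ) * Complex.I) + β))⁻¹ =
      ((Real.Gamma (α * k + β))⁻¹ : ℝ) := by
    rw [Complex.ofReal_inv, ← Complex.Gamma_ofReal]
    push_cast
    simp
  rw [hcast, Complex.norm_real, abs_zero, mul_zero, Real.exp_zero, mul_one,
    Real.rpow_neg hb.le, Real.rpow_natCast] at hG
  rw [div_eq_mul_inv, norm_mul, norm_pow, Real.norm_eq_abs x]
  calc |x| ^ k * ‖(Real.Gamma (α * k + β))⁻¹‖
      ≤ (|x| + 1) ^ k * (C * ((2 * (|x| + 1)) ^ k)⁻¹) := by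
        gcongr
        linarith
    _ = C * (1 / 2) ^ k := by
        rw [mul_pow, one_div, inv_pow]
        field_simp

theorem exists_abs_mittagLeffler_le {α : ℝ} (hα0 : 0 < α) (hα2 : α < 2) (β : ℝ) :
    ∃ C, 0 ≤ C ∧ ∀ η ≥ (1 : ℝ), |mittagLeffler α β (-η)| ≤ C := by
  have hpi := Real.pi_pos
  obtain ⟨δ, hδ1, hδ2⟩ : ∃ δ, Real.pi / 2 < δ ∧ δ < Real.pi / α :=
    exists_between (div_lt_div_of_pos_left hpi hα0 hα2)
  have hμ : α * δ < Real.pi := by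
    rwa [lt_div_iff₀ hα0, mul_comm] at hδ2
  have hμ0 : 0 ≤ α * δ := by
    have : 0 < δ := by linarith
    positivity
  obtain ⟨C, hC, h⟩ := exists_norm_Gamma_inv_linear_le hα0 β hδ1 one_pos
  set K := ∫ t : ℝ, Real.exp (α * δ * |t|) / Real.cosh (Real.pi * t)
  have hK : 0 ≤ K := MeasureTheory.integral_nonneg fun t => by
    have := Real.cosh_pos (Real.pi * t)
    simp only [Pi.zero_apply]
    positivity
  refine ⟨C * K / 2, by positivity, fun η hη => ?_⟩
  have hη0 : 0 < η := by linarith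
  have hηne : (η : ℂ) ≠ 0 := by exact_mod_cast hη0.ne'
  set g : ℂ → ℂ := fun w => (η : ℂ) ^ w * (Complex.Gamma (α * w + β))⁻¹ with hg
  have hgd : Differentiable ℂ g :=
    (differentiable_id.const_cpow (Or.inl hηne)).mul
      (Complex.differentiable_one_div_Gamma.comp
        ((differentiable_id.const_mul (α : ℂ)).add_const (β : ℂ)))
  have hgn : ∀ x y : ℝ, ‖g (x + y * Complex.I)‖ =
      η ^ x * ‖(Complex.Gamma (α * (x + y * Complex.I) + β))⁻¹‖ := by
    intro x y
    simp only [hg]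
    rw [norm_mul, Complex.norm_cpow_eq_rpow_re_of_pos hη0]
    simp
  obtain ⟨C', hC', h'⟩ := exists_norm_Gamma_inv_linear_le hα0 β hδ1
    (by positivity : 0 < 2 * η)
  have hlim := tendsto_alternating_sum hgd (C := C') hμ0 hμ (r := 2⁻¹)
    (by norm_num) (by norm_num) fun x y hx => by
      rw [hgn]
      calc η ^ x * ‖(Complex.Gamma (α * (x + y * Complex.I) + β))⁻¹‖
          ≤ η ^ x * (C' * (2 * η) ^ (-x) * Real.exp (α * δ * |y|)) := by
            gcongr
            exact h' x y hx
        _ = C' * 2⁻¹ ^ x * Real.exp (α * δ * |y|) := by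
            rw [Real.rpow_neg (by positivity), Real.mul_rpow (by norm_num) hη0.le,
              Real.inv_rpow (by norm_num)]
            have := (Real.rpow_pos_of_pos hη0 x).ne'
            field_simp
  have hsum := (Complex.continuous_ofReal.tendsto _).comp
    (summable_mittagLeffler hα0 β (-η)).hasSum.tendsto_sum_nat
  have heq : ((mittagLeffler α β (-η) : ℝ) : ℂ) = _ :=
    tendsto_nhds_unique (hsum.congr fun N => by
      simp only [Function.comp_apply, Complex.ofReal_sum, hg]
      refine Finset.sum_congr rfl fun k _ => ?_
      rw [Complex.cpow_natCast, neg_pow, div_eq_mul_inv, Complex.ofReal_mul, Complex.ofReal_mul,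
        Complex.ofReal_inv, ← Complex.Gamma_ofReal]
      push_cast
      ring) hlim
  rw [← Real.norm_eq_abs, ← Complex.norm_real, heq, norm_div, Complex.norm_ofNat]
  gcongr
  refine norm_integral_div_cosh_le hμ _ fun y => ?_
  rw [hgn]
  have hle := h (-1 / 2) y le_rfl
  rw [Real.one_rpow, mul_one] at hle
  have hη1 : η ^ (-1 / 2 : ℝ) ≤ 1 := Real.rpow_le_one_of_one_le_of_nonpos hη (by norm_num)
  exact (mul_le_of_le_one_left (norm_nonneg _) hη1).trans hle

theorem mittagLeffler_sub_eq {α : ℝ} (hα : 0 < α) (β x : ℝ) :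
    mittagLeffler α (β - α) x = (Real.Gamma (β - α))⁻¹ + x * mittagLeffler α β x := by
  rw [mittagLeffler, (summable_mittagLeffler hα (β - α) x).tsum_eq_zero_add, mittagLeffler,
    ← tsum_mul_left]
  congr 1
  · simp
  · congr 1 with k
    rw [pow_succ, show α * ((k + 1 : ℕ) : ℝ) + (β - α) = α * k + β by push_cast; ring]
    ring

theorem abs_mittagLeffler_le_tsum {α : ℝ} (hα : 0 < α) (β : ℝ) {x : ℝ} (hx : |x| ≤ 1) :
    |mittagLeffler α β x| ≤ ∑' k : ℕ, |(Real.Gamma (α * k + β))⁻¹| := by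
  have hs : Summable fun k : ℕ => |(Real.Gamma (α * k + β))⁻¹| := by
    simpa using (summable_mittagLeffler hα β 1).abs
  rw [← Real.norm_eq_abs, mittagLeffler]
  refine tsum_of_norm_bounded hs.hasSum fun k => ?_
  rw [div_eq_mul_inv, norm_mul, norm_pow, Real.norm_eq_abs, Real.norm_eq_abs]
  exact mul_le_of_le_one_left (abs_nonneg _) (pow_le_one₀ (abs_nonneg _) hx)

/-- For every `0 < α < 2` and every real `β`, there is a constant `C = C(α,β) > 0` such that
`|E_{α,β}(-η)| ≤ C/(1+η)` for all `η ≥ 0`. -/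
theorem mittagLeffler_decay_bound (α : ℝ) (hα0 : 0 < α) (hα2 : α < 2) (β : ℝ) :
    ∃ C > (0 : ℝ), ∀ η ≥ (0 : ℝ), |mittagLeffler α β (-η)| ≤ C / (1 + η) := by
  obtain ⟨B, hB, hbound⟩ := exists_abs_mittagLeffler_le hα0 hα2 (β - α)
  set S := ∑' k : ℕ, |(Real.Gamma (α * k + β))⁻¹|
  have hS : 0 ≤ S := tsum_nonneg fun k => abs_nonneg _
  set G := |(Real.Gamma (β - α))⁻¹|
  have hG : 0 ≤ G := abs_nonneg _
  refine ⟨2 * (B + G + S) + 1, by positivity, fun η hη => ?_⟩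
  rw [le_div_iff₀ (by linarith)]
  rcases le_total η 1 with h1 | h1
  · have := abs_mittagLeffler_le_tsum hα0 β (x := -η) (by rwa [abs_neg, abs_of_nonneg hη])
    nlinarith [abs_nonneg (mittagLeffler α β (-η))]
  · have hrec := mittagLeffler_sub_eq hα0 β (-η)
    have hmul : η * |mittagLeffler α β (-η)| ≤ G + B := by
      rw [← abs_of_nonneg hη, ← abs_mul, abs_of_nonneg hη,
        show η * mittagLeffler α β (-η) =
          (Real.Gamma (β - α))⁻¹ - mittagLeffler α (β - α) (-η) by linarith]
      exact (abs_sub _ _).trans (add_le_add le_rfl (hbound η h1))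
    nlinarith [abs_nonneg (mittagLeffler α β (-η))]
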